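/- arXiv:1309.3381 — 2 statements merged into one kernel-verified Lean document; each statement's English description precedes it below -/
import Mathlib

section
/- Two finitely generated Abelian groups of non-zero rank admit equal growth functions with respect to finite symmetric generating sets if and only if they have the same rank and their torsion subgroups have cardinalities of the same parity. That is, for finitely generated Abelian groups G and G' with rk G ≥ 1 and rk G' ≥ 1, there exist finite symmetric generating sets S ⊆ G and S' ⊆ G' with β_{G,S} = β_{G',S'} if and only if rk G = rk G' and |tors G| ≡ |tors G'| (mod 2). -/
/-- `S` is a monoid generating set of the group `G`: every element of `G` is a
product of finitely many elements of `S`. -/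
def IsMonGenSet {G : Type*} [Group G] (S : Set G) : Prop := Submonoid.closure S = ⊤

/-- `S` is symmetric: closed under inverses. -/
def IsSymmSet {G : Type*} [Group G] (S : Set G) : Prop := ∀ s ∈ S, s⁻¹ ∈ S

/-- The word length of `g` with respect to `S`: the least `n` such that `g` is a
product of `n` elements of `S`. -/
noncomputable def wlen {G : Type*} [Group G] (S : Set G) (g : G) : ℕ :=
  sInf {n | ∃ l : List G, (∀ x ∈ l, x ∈ S) ∧ l.length = n ∧ l.prod = g}

/-- The growth function `β_{G,S}`: the cardinality of the ball of radius `r`. -/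
noncomputable def growth {G : Type*} [Group G] (S : Set G) (r : ℕ) : ℕ :=
  Set.ncard {g : G | wlen S g ≤ r}

/-- The spherical growth function `σ_{G,S}`. -/
noncomputable def sph {G : Type*} [Group G] (S : Set G) (r : ℕ) : ℕ :=
  Set.ncard {g : G | wlen S g = r}

/-- The standard symmetric generating set `E_d ∪ (-E_d)` of `ℤ^d`. -/
def stdSymmSet (d : ℕ) : Set (Multiplicative (Fin d → ℤ)) :=
  {x | ∃ i : Fin d, x = Multiplicative.ofAdd (Pi.single i 1) ∨
       x = Multiplicative.ofAdd (-Pi.single i 1)}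

/-- The standard symmetric growth function `β_d` of `ℤ^d`. -/
noncomputable def betaStd (d : ℕ) : ℕ → ℕ := growth (stdSymmSet d)

/-- The standard monoid generating set `E_d ∪ {v_d}` of `ℤ^d`. -/
def stdMonSet (d : ℕ) : Set (Multiplicative (Fin d → ℤ)) :=
  {x | (∃ i : Fin d, x = Multiplicative.ofAdd (Pi.single i 1)) ∨
       x = Multiplicative.ofAdd (fun _ => (-1 : ℤ))}

/-- The standard monoid growth function `β⁺_d` of `ℤ^d`. -/
noncomputable def betaPlus (d : ℕ) : ℕ → ℕ := growth (stdMonSet d)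

/-- The rank of a finitely generated abelian group. -/
noncomputable def rk (G : Type*) [CommGroup G] : ℕ := Module.finrank ℤ (Additive G)

open Pointwise in
/-- For a monoid generating set, the ball of radius `r` is a pointwise power. -/
theorem setOf_wlen_le {G : Type*} [Group G] {S : Set G} (hS : IsMonGenSet S) (r : ℕ) :
    {g : G | wlen S g ≤ r} = (insert 1 S) ^ r := by
  ext g
  simp only [Set.mem_ofPred_eq]
  constructor
  · intro h
    have hne : {n | ∃ l : List G, (∀ x ∈ l, x ∈ S) ∧ l.length = n ∧ l.prod = g}.Nonempty := by
      obtain ⟨l, hl, hp⟩ := Submonoid.exists_list_of_mem_closure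
        (show g ∈ Submonoid.closure S by rw [show Submonoid.closure S = ⊤ from hS]; trivial)
      exact ⟨_, l, hl, rfl, hp⟩
    obtain ⟨l, hl, hlen, rfl⟩ := Nat.sInf_mem hne
    have key : ∀ l : List G, (∀ x ∈ l, x ∈ S) → l.prod ∈ (insert 1 S) ^ l.length := by
      intro l hl
      induction l with
      | nil => simp
      | cons a t ih =>
        rw [List.prod_cons, List.length_cons, pow_succ']
        exact Set.mul_mem_mul (Set.mem_insert_of_mem _ (hl a (by simp)))
          (ih fun x hx => hl x (by simp [hx]))
    refine Set.pow_subset_pow_right (Set.mem_insert 1 S) ?_ (key l hl)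
    rw [hlen]
    exact h
  · intro h
    suffices ∃ l : List G, (∀ x ∈ l, x ∈ S) ∧ l.length ≤ r ∧ l.prod = g by
      obtain ⟨l, hl, hlen, hp⟩ := this
      have hmem : l.length ∈
          {n | ∃ l : List G, (∀ x ∈ l, x ∈ S) ∧ l.length = n ∧ l.prod = g} := ⟨l, hl, rfl, hp⟩
      exact (Nat.sInf_le hmem).trans hlen
    induction r generalizing g with
    | zero =>
      rw [pow_zero, Set.mem_one] at h
      exact ⟨[], by simp, by simp, by simp [h]⟩
    | succ r ih =>
      rw [pow_succ'] at h
      obtain ⟨a, ha, b, hb, rfl⟩ := h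
      obtain ⟨l, hl, hlen, rfl⟩ := ih b hb
      rcases ha with rfl | ha
      · exact ⟨l, hl, by omega, by simp⟩
      · refine ⟨a :: l, ?_, by simpa using hlen, by simp⟩
        simpa [ha] using hl

open Pointwise in
theorem growth_eq_ncard_pow {G : Type*} [Group G] {S : Set G} (hS : IsMonGenSet S) (r : ℕ) :
    growth S r = ((insert 1 S) ^ r).ncard := by
  rw [growth, setOf_wlen_le hS]

open Pointwise in
theorem growth_eq_ncard_pow_of_one_mem {G : Type*} [Group G] {S : Set G} (hS : IsMonGenSet S)
    (h1 : 1 ∈ S) (r : ℕ) : growth S r = (S ^ r).ncard := by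
  rw [growth_eq_ncard_pow hS, Set.insert_eq_of_mem h1]

open Pointwise in
theorem isMonGenSet_of_forall_mem_pow {G : Type*} [Group G] {S : Set G}
    (h : ∀ g, ∃ r : ℕ, g ∈ S ^ r) : IsMonGenSet S := by
  refine (Submonoid.eq_top_iff' _).2 fun g => ?_
  obtain ⟨r, hr⟩ := h g
  induction r generalizing g with
  | zero =>
    rw [pow_zero, Set.mem_one] at hr
    exact hr ▸ one_mem _
  | succ r ih =>
    rw [pow_succ] at hr
    obtain ⟨a, ha, b, hb, rfl⟩ := hr
    exact mul_mem (ih a ha) (Submonoid.subset_closure hb)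

open Pointwise in
theorem exists_subset_pow {G : Type*} [Group G] {S : Set G} (hS : IsMonGenSet S)
    {F : Set G} (hF : F.Finite) : ∃ K : ℕ, F ⊆ (insert 1 S) ^ K := by
  refine ⟨hF.toFinset.sup (wlen S), fun g hg => ?_⟩
  rw [← setOf_wlen_le hS]
  exact Finset.le_sup (f := wlen S) (hF.mem_toFinset.2 hg)

open Pointwise in
theorem finite_insert_one_pow {G : Type*} [Group G] {S : Set G} (hS : S.Finite) (r : ℕ) :
    ((insert 1 S) ^ r).Finite := by
  induction r with
  | zero => simp
  | succ r ih => exact pow_succ (insert 1 S) r ▸ ih.mul (hS.insert 1)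

open Pointwise in
theorem growth_le_polynomial {G T : Type*} [Group G] [Group T] [Finite T] {d : ℕ}
    (e : G ≃* (Fin d → Multiplicative ℤ) × T) {S : Set G} (hS : S.Finite) (hg : IsMonGenSet S) :
    ∃ C : ℕ, ∀ r, growth S r ≤ C * (r + 1) ^ d := by
  obtain ⟨M, hM⟩ : ∃ M : ℕ, ∀ g ∈ insert 1 S, ∀ i, (((e g).1 i).toAdd).natAbs ≤ M := by
    refine ⟨(hS.insert 1).toFinset.sup fun g => Finset.univ.sup fun i =>
      (((e g).1 i).toAdd).natAbs, fun g hg i => ?_⟩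
    exact (Finset.le_sup (f := fun i => (((e g).1 i).toAdd).natAbs) (Finset.mem_univ i)).trans
      (Finset.le_sup (f := fun g => Finset.univ.sup fun i => (((e g).1 i).toAdd).natAbs)
        ((hS.insert 1).mem_toFinset.2 hg))
  have hpow : ∀ (r : ℕ), ∀ g ∈ (insert 1 S) ^ r, ∀ i, (((e g).1 i).toAdd).natAbs ≤ M * r := by
    intro r
    induction r with
    | zero => intro g hg i; simp at hg; simp [hg]
    | succ r ih =>
      intro g hg i
      rw [pow_succ] at hg
      obtain ⟨a, ha, b, hb, rfl⟩ := hg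
      have h1 := ih a ha i
      have h2 := hM b hb i
      simp only [map_mul, Prod.fst_mul, Pi.mul_apply, toAdd_mul]
      rw [mul_add, mul_one]
      omega
  refine ⟨Nat.card T * (2 * M + 1) ^ d, fun r => ?_⟩
  have := Fintype.ofFinite T
  classical
  let F : Finset ((Fin d → ℤ) × T) :=
    (Fintype.piFinset fun _ => Finset.Icc (-(M * r : ℤ)) (M * r)) ×ˢ Finset.univ
  let f : G → (Fin d → ℤ) × T := fun g => (fun i => ((e g).1 i).toAdd, (e g).2)
  have hf : Function.Injective f := by
    intro x y hxy
    apply e.injective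
    refine Prod.ext (funext fun i => ?_) (congrArg Prod.snd hxy)
    exact Multiplicative.toAdd.injective (congrFun (congrArg Prod.fst hxy) i)
  have hmaps : ∀ g ∈ (insert 1 S) ^ r, f g ∈ (F : Set ((Fin d → ℤ) × T)) := by
    intro g hg
    simp only [F, Finset.coe_product, Set.mem_prod, Finset.mem_coe, Fintype.mem_piFinset,
      Finset.mem_Icc, Finset.mem_univ, and_true]
    intro i
    have := hpow r g hg i
    have h2 : ((((e g).1 i).toAdd).natAbs : ℤ) ≤ M * r := by exact_mod_cast this
    simp only [f]
    omega
  rw [growth_eq_ncard_pow hg]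
  have h1 := Set.ncard_le_ncard_of_injOn f hmaps hf.injOn F.finite_toSet
  rw [Set.ncard_coe_finset] at h1
  refine h1.trans ?_
  simp only [F, Finset.card_product, Fintype.card_piFinset, Int.card_Icc, Finset.prod_const,
    Finset.card_univ, Fintype.card_fin, Nat.card_eq_fintype_card]
  have h2 : ((M * r : ℤ) + 1 - -(M * r)).toNat = 2 * (M * r) + 1 := by
    have : (M * r : ℤ) = ((M * r : ℕ) : ℤ) := by push_cast; rfl
    omega
  rw [h2, mul_comm, mul_assoc, ← mul_pow]
  gcongr
  nlinarith

open Pointwise in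
theorem polynomial_le_growth {G T : Type*} [Group G] [Group T] {d : ℕ}
    (e : G ≃* (Fin d → Multiplicative ℤ) × T) {S : Set G} (hS : S.Finite) (hg : IsMonGenSet S) :
    ∃ K : ℕ, ∀ r, (r + 1) ^ d ≤ growth S (K * r) := by
  let f : (Fin d → ℤ) → G := fun v => e.symm (fun i => Multiplicative.ofAdd (v i), 1)
  have hf : Function.Injective f := by
    intro x y hxy
    have := congrArg Prod.fst (e.symm.injective hxy)
    exact funext fun i => Multiplicative.ofAdd.injective (congrFun this i)
  have hadd : ∀ v w, f (v + w) = f v * f w := by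
    intro v w
    simp only [f, ← map_mul]
    congr 1
    ext <;> simp
  let box : ℕ → Finset (Fin d → ℤ) := fun r => Fintype.piFinset fun _ => Finset.Icc 0 (r : ℤ)
  obtain ⟨K, hK⟩ := exists_subset_pow hg ((box 1).finite_toSet.image f)
  have hbox : ∀ r : ℕ, ∀ v ∈ box r, f v ∈ (insert 1 S) ^ (K * r) := by
    intro r
    induction r with
    | zero =>
      intro v hv
      have : v = 0 := by
        ext i
        have := Fintype.mem_piFinset.1 hv i
        simp only [Finset.mem_Icc] at this
        simp only [Pi.zero_apply]
        omega
      subst this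
      have : f 0 = 1 := by
        have := hadd 0 0
        simpa using this
      simp [this]
    | succ r ih =>
      intro v hv
      have hv := fun i => Finset.mem_Icc.1 (Fintype.mem_piFinset.1 hv i)
      have hsplit : v = (fun i => v i - min (v i) 1) + (fun i => min (v i) 1) := by
        ext i; simp
      rw [hsplit, hadd, mul_add, mul_one, pow_add]
      refine Set.mul_mem_mul (ih _ ?_) (hK ⟨_, ?_, rfl⟩)
      · refine Fintype.mem_piFinset.2 fun i => Finset.mem_Icc.2 ?_
        have := hv i
        push_cast at this
        omega
      · refine Finset.mem_coe.2 (Fintype.mem_piFinset.2 fun i => Finset.mem_Icc.2 ?_)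
        have := hv i
        push_cast at this ⊢
        omega
  refine ⟨K, fun r => ?_⟩
  rw [growth_eq_ncard_pow hg]
  have h1 := Set.ncard_le_ncard_of_injOn (s := (box r : Set (Fin d → ℤ))) f
    (fun v hv => hbox r v hv) hf.injOn (finite_insert_one_pow hS _)
  rw [Set.ncard_coe_finset] at h1
  simpa [box] using h1

theorem rank_le_of_growth_eq {G T G' T' : Type*} [Group G] [Group T] [Finite T] [Group G']
    [Group T'] {d d' : ℕ} (e : G ≃* (Fin d → Multiplicative ℤ) × T)
    (e' : G' ≃* (Fin d' → Multiplicative ℤ) × T') {S : Set G} {S' : Set G'}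
    (hS : S.Finite) (hS' : S'.Finite) (hg : IsMonGenSet S) (hg' : IsMonGenSet S')
    (h : growth S = growth S') : d' ≤ d := by
  obtain ⟨C, hC⟩ := growth_le_polynomial e hS hg
  obtain ⟨K, hK⟩ := polynomial_le_growth e' hS' hg'
  by_contra! hlt
  set N := C * (K + 1) ^ d
  have h1 := (hK N).trans ((congrFun h _).symm.le.trans (hC (K * N)))
  have h2 : (K * N + 1) ^ d ≤ ((K + 1) * (N + 1)) ^ d := by
    gcongr
    nlinarith
  have h3 : (N + 1) ^ (d + 1) ≤ (N + 1) ^ d' := Nat.pow_le_pow_right (by omega) hlt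
  have h4 : (N + 1) ^ (d + 1) ≤ N * (N + 1) ^ d :=
    calc _ ≤ C * (K * N + 1) ^ d := h3.trans h1
      _ ≤ C * ((K + 1) * (N + 1)) ^ d := by gcongr
      _ = N * (N + 1) ^ d := by rw [mul_pow]; ring
  rw [pow_succ'] at h4
  have := Nat.le_of_mul_le_mul_right h4 (by positivity)
  omega

open Pointwise in
theorem growth_mod_two {G : Type*} [CommGroup G] [Finite (CommGroup.torsion G)] {S : Set G}
    (hS : S.Finite) (hsymm : IsSymmSet S) (hg : IsMonGenSet S) :
    ∃ R, ∀ r ≥ R, growth S r % 2 = Nat.card (CommGroup.torsion G) % 2 := by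
  classical
  obtain ⟨R, hR⟩ := exists_subset_pow hg (Set.toFinite (CommGroup.torsion G : Set G))
  refine ⟨R, fun r hr => ?_⟩
  have hR := hR.trans (Set.pow_subset_pow_right (Set.mem_insert 1 S) hr)
  have hinv : (insert 1 S)⁻¹ = insert 1 S := by
    ext x
    simp only [Set.mem_inv, Set.mem_insert_iff, inv_eq_one]
    refine or_congr_right ⟨fun h => ?_, hsymm x⟩
    simpa using hsymm _ h
  have hpinv : ((insert 1 S) ^ r)⁻¹ = (insert 1 S) ^ r := by rw [← inv_pow, hinv]
  have hfin := finite_insert_one_pow hS r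
  rw [growth_eq_ncard_pow hg, ← Set.ncard_sdiff_add_ncard_of_subset hR hfin]
  have heven : ((((insert 1 S) ^ r \ (CommGroup.torsion G : Set G)).ncard : ℕ) : ZMod 2) = 0 := by
    have hD : ((insert 1 S) ^ r \ (CommGroup.torsion G : Set G)).Finite := hfin.sdiff
    rw [Set.ncard_eq_toFinset_card _ hD, Finset.cast_card]
    refine Finset.sum_involution (fun g _ => g⁻¹) (fun _ _ => by decide) ?_ ?_ (by simp)
    · intro g hg _ hgg
      refine ((hD.mem_toFinset.1 hg).2) ?_
      refine isOfFinOrder_iff_pow_eq_one.2 ⟨2, by norm_num, ?_⟩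
      rw [pow_two]
      nth_rewrite 1 [← hgg]
      simp
    · intro g hg
      have hg := hD.mem_toFinset.1 hg
      refine hD.mem_toFinset.2 ⟨?_, ?_⟩
      · rw [← Set.mem_inv, hpinv]
        exact hg.1
      · simpa using hg.2
  rw [ZMod.natCast_eq_zero_iff] at heven
  have : (CommGroup.torsion G : Set G).ncard = Nat.card (CommGroup.torsion G) := rfl
  omega

/-- The truncated strip in `ℤ × T`: all of `T` over `|x| ≤ R - i`, and only the identity over the
further points with `|x| ≤ R - j` or `|x| = R`. -/
def strip (T : Type*) [Group T] (R i j : ℤ) : Set (Multiplicative ℤ × T) :=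
  {x | |x.1.toAdd| ≤ R - i ∨ (x.2 = 1 ∧ (|x.1.toAdd| ≤ R - j ∨ |x.1.toAdd| = R))}

theorem one_mem_strip (T : Type*) [Group T] {R i j : ℤ} (h : i ≤ R) :
    1 ∈ strip T R i j := by
  left
  simpa using h

theorem inv_mem_strip {T : Type*} [Group T] {R i j : ℤ} {x : Multiplicative ℤ × T}
    (hx : x ∈ strip T R i j) : x⁻¹ ∈ strip T R i j := by
  simpa [strip] using hx

open Pointwise in
theorem strip_mul_strip (T : Type*) [Group T] {a R i j : ℤ} (hj : 1 ≤ j) (hji : j ≤ i)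
    (hi : 2 * i ≤ a) (hR : a ≤ R) : strip T R i j * strip T a i j = strip T (R + a) i j := by
  ext ⟨z, t⟩
  induction z using Multiplicative.rec with | _ z => ?_
  constructor
  · rintro ⟨⟨x, s⟩, hx, ⟨y, u⟩, hy, h⟩
    obtain ⟨h1, rfl⟩ := Prod.ext_iff.1 h
    have h1 : x.toAdd + y.toAdd = z := congrArg Multiplicative.toAdd h1
    simp only [strip, Set.mem_ofPred_eq, toAdd_ofAdd] at hx hy ⊢
    subst h1
    generalize x.toAdd = x at *
    generalize y.toAdd = y at *
    rcases hx with hx | ⟨rfl, hx⟩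
    · left
      grind
    · rcases hy with hy | ⟨rfl, hy⟩
      · left
        grind
      · right
        refine ⟨by simp, ?_⟩
        grind
  · intro h
    simp only [strip, Set.mem_ofPred_eq, toAdd_ofAdd] at h
    obtain ⟨y, hy, hz⟩ : ∃ y : ℤ, (|y| ≤ a - i ∨ |y| = a) ∧
        (|z - y| ≤ R - i ∨ (t = 1 ∧ (|z - y| ≤ R - j ∨ |z - y| = R))) := by
      rcases le_or_gt i z with h1 | h1
      · refine ⟨a, by grind, ?_⟩
        rcases h with h | ⟨ht, h⟩
        · left; grind
        · right; refine ⟨ht, ?_⟩; grind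
      · rcases le_or_gt z (-i) with h2 | h2
        · refine ⟨-a, by grind, ?_⟩
          rcases h with h | ⟨ht, h⟩
          · left; grind
          · right; refine ⟨ht, ?_⟩; grind
        · refine ⟨0, Or.inl (by rw [abs_zero]; omega), Or.inl ?_⟩
          rw [sub_zero, abs_le]
          omega
    refine ⟨(Multiplicative.ofAdd (z - y), t), ?_, (Multiplicative.ofAdd y, 1), ?_, ?_⟩
    · simpa [strip] using hz
    · simp only [strip, Set.mem_ofPred_eq, toAdd_ofAdd, true_and]
      grind
    · simp

open Pointwise in
theorem strip_pow (T : Type*) [Group T] {a i j : ℤ} (hj : 1 ≤ j) (hji : j ≤ i)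
    (hi : 2 * i ≤ a) (r : ℕ) : strip T a i j ^ (r + 1) = strip T (a * (r + 1)) i j := by
  induction r with
  | zero => simp
  | succ r ih =>
    rw [pow_succ, ih, strip_mul_strip T hj hji hi (by nlinarith)]
    congr 1
    push_cast
    ring

theorem coe_ncard_strip (T : Type*) [Group T] [Finite T] {R i j : ℤ} (hj : 1 ≤ j) (hji : j ≤ i)
    (hR : i ≤ R) : ((strip T R i j).ncard : ℤ)
      = Nat.card T * (2 * (R - i) + 1) + 2 * (i - j) + 2 := by
  have := Fintype.ofFinite T
  classical
  let A : Finset ℤ := Finset.Icc (-(R - i)) (R - i)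
  let B : Finset ℤ := (Finset.Ico (-(R - j)) (-(R - i)) ∪ Finset.Ioc (R - i) (R - j)) ∪ {-R, R}
  let F : Finset (ℤ × T) := A ×ˢ Finset.univ ∪ B ×ˢ {1}
  have hF : strip T R i j = (fun p : ℤ × T => (Multiplicative.ofAdd p.1, p.2)) '' F := by
    ext ⟨x, t⟩
    induction x using Multiplicative.rec with | _ x => ?_
    have : (Multiplicative.ofAdd x, t) ∈ (fun p : ℤ × T => (Multiplicative.ofAdd p.1, p.2)) '' F
        ↔ (x, t) ∈ F := by
      simp
    rw [this]
    simp only [strip, Set.mem_ofPred_eq, toAdd_ofAdd, F, A, B, Finset.mem_union,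
      Finset.mem_product, Finset.mem_Icc, Finset.mem_Ico, Finset.mem_Ioc, Finset.mem_univ,
      Finset.mem_insert, Finset.mem_singleton]
    by_cases ht : t = 1 <;> simp only [ht, true_and, and_true, false_and, and_false, or_false] <;>
      grind
  have hinj : Function.Injective (fun p : ℤ × T => (Multiplicative.ofAdd p.1, p.2)) := by
    rintro ⟨x, s⟩ ⟨y, t⟩ h
    simpa using h
  rw [hF, Set.ncard_image_of_injective _ hinj, Set.ncard_coe_finset]
  have hAB : Disjoint A B := by
    rw [Finset.disjoint_left]
    intro x
    simp only [A, B, Finset.mem_union, Finset.mem_Icc, Finset.mem_Ico, Finset.mem_Ioc,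
      Finset.mem_insert, Finset.mem_singleton]
    omega
  have hB : (B.card : ℤ) = 2 * (i - j) + 2 := by
    simp only [B]
    rw [Finset.card_union_of_disjoint, Finset.card_union_of_disjoint, Finset.card_pair (by omega),
      Int.card_Ico, Int.card_Ioc]
    · push_cast
      omega
    · rw [Finset.disjoint_left]
      intro x
      simp only [Finset.mem_Ico, Finset.mem_Ioc]
      omega
    · rw [Finset.disjoint_left]
      intro x
      simp only [Finset.mem_union, Finset.mem_Ico, Finset.mem_Ioc, Finset.mem_insert,
        Finset.mem_singleton]
      omega
  have hA : (A.card : ℤ) = 2 * (R - i) + 1 := by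
    simp only [A, Int.card_Icc]
    omega
  rw [Finset.card_union_of_disjoint (Finset.disjoint_product.2 (Or.inl hAB)), Finset.card_product,
    Finset.card_product, Finset.card_univ, Nat.card_eq_fintype_card, Finset.card_singleton]
  push_cast
  rw [hA, hB]
  ring

theorem finite_strip (T : Type*) [Group T] [Finite T] {R i j : ℤ} (hj : 1 ≤ j) (hji : j ≤ i)
    (hR : i ≤ R) : (strip T R i j).Finite := by
  refine Set.finite_of_ncard_pos ?_
  have := coe_ncard_strip T hj hji hR
  have h2 : 0 ≤ (Nat.card T : ℤ) * (2 * (R - i) + 1) := by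
    have : 0 ≤ R - i := by omega
    positivity
  omega

open Pointwise in
theorem exists_mem_strip_pow (T : Type*) [Group T] {a i j : ℤ} (hj : 1 ≤ j) (hji : j ≤ i)
    (hi : 2 * i ≤ a) (g : Multiplicative ℤ × T) : ∃ r : ℕ, g ∈ strip T a i j ^ r := by
  refine ⟨g.1.toAdd.natAbs + 1, ?_⟩
  rw [strip_pow T hj hji hi]
  left
  rw [Int.abs_eq_natAbs]
  nlinarith [Int.natCast_nonneg g.1.toAdd.natAbs]

open Pointwise in
/-- Numerical condition under which powers of two strips have equal cardinalities. -/
theorem ncard_strip_pow_eq {T T' : Type*} [Group T] [Finite T] [Group T'] [Finite T']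
    {a i j a' i' j' : ℤ} (hj : 1 ≤ j) (hji : j ≤ i) (hi : 2 * i ≤ a)
    (hj' : 1 ≤ j') (hji' : j' ≤ i') (hi' : 2 * i' ≤ a')
    (ha : Nat.card T * a = Nat.card T' * a')
    (hc : Nat.card T * (1 - 2 * i) + 2 * (i - j) = Nat.card T' * (1 - 2 * i') + 2 * (i' - j'))
    (r : ℕ) : (strip T a i j ^ r).ncard = (strip T' a' i' j' ^ r).ncard := by
  cases r with
  | zero => simp [← Set.singleton_one]
  | succ r =>
    rw [strip_pow T hj hji hi, strip_pow T' hj' hji' hi']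
    have h1 := coe_ncard_strip T (R := a * (r + 1)) hj hji (by nlinarith)
    have h2 := coe_ncard_strip T' (R := a' * (r + 1)) hj' hji' (by nlinarith)
    zify
    rw [h1, h2]
    linear_combination 2 * (r + 1 : ℤ) * ha + hc

open Pointwise in
theorem exists_strip_ncard_pow_eq (T T' : Type*) [Group T] [Finite T] [Group T'] [Finite T']
    (h : Nat.card T % 2 = Nat.card T' % 2) :
    ∃ a i j a' i' j' : ℤ, (1 ≤ j ∧ j ≤ i ∧ 2 * i ≤ a) ∧ (1 ≤ j' ∧ j' ≤ i' ∧ 2 * i' ≤ a') ∧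
      ∀ r : ℕ, (strip T a i j ^ r).ncard = (strip T' a' i' j' ^ r).ncard := by
  have hT : 0 < Nat.card T := Nat.card_pos
  have hT' : 0 < Nat.card T' := Nat.card_pos
  rcases Nat.even_or_odd' (Nat.card T) with ⟨p, hp | hp⟩ <;>
    rcases Nat.even_or_odd' (Nat.card T') with ⟨q, hq | hq⟩
  · refine ⟨2 * Nat.card T', q, 1, 2 * Nat.card T, p, 1, ⟨by omega, by omega, by omega⟩,
      ⟨by omega, by omega, by omega⟩, ?_⟩
    refine ncard_strip_pow_eq (by omega) (by omega) (by omega) (by omega) (by omega) (by omega)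
      (by ring) ?_
    rw [hp, hq]
    push_cast
    ring
  · omega
  · omega
  · refine ⟨2 * Nat.card T', q + 1, q + 1, 2 * Nat.card T, p + 1, p + 1,
      ⟨by omega, by omega, by omega⟩, ⟨by omega, by omega, by omega⟩, ?_⟩
    refine ncard_strip_pow_eq (by omega) (by omega) (by omega) (by omega) (by omega) (by omega)
      (by ring) ?_
    rw [hp, hq]
    push_cast
    ring

open Pointwise in
theorem exists_finite_symm_generating (K : Type*) [Group K] (hK : Group.FG K) :
    ∃ P : Set K, P.Finite ∧ IsSymmSet P ∧ 1 ∈ P ∧ ∀ g, ∃ r : ℕ, g ∈ P ^ r := by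
  obtain ⟨S, hS, hfin⟩ := Monoid.fg_iff.1 (Group.fg_iff_monoid_fg.1 hK)
  refine ⟨insert 1 (S ∪ S⁻¹), (hfin.union hfin.inv).insert 1, ?_, Set.mem_insert _ _, fun g => ?_⟩
  · intro s hs
    simp only [Set.mem_insert_iff, Set.mem_union, Set.mem_inv, inv_inv, inv_eq_one] at hs ⊢
    tauto
  · have hgen : IsMonGenSet (S ∪ S⁻¹) :=
      top_le_iff.1 (hS ▸ Submonoid.closure_mono Set.subset_union_left)
    obtain ⟨r, hr⟩ := exists_subset_pow hgen (Set.finite_singleton g)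
    exact ⟨r, hr rfl⟩

open Pointwise in
/-- Pulling back `A ×ˢ P` along an isomorphism gives a symmetric generating set whose growth is
the product of the growths of `A` and `P`. -/
theorem product_generating_set {G H K : Type*} [Group G] [Group H] [Group K] (e : G ≃* H × K)
    {A : Set H} {P : Set K} (hA : A.Finite) (hAs : IsSymmSet A) (hA1 : 1 ∈ A)
    (hAg : ∀ g, ∃ r : ℕ, g ∈ A ^ r) (hP : P.Finite) (hPs : IsSymmSet P) (hP1 : 1 ∈ P)
    (hPg : ∀ g, ∃ r : ℕ, g ∈ P ^ r) :
    (e.symm '' (A ×ˢ P)).Finite ∧ IsSymmSet (e.symm '' (A ×ˢ P)) ∧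
      IsMonGenSet (e.symm '' (A ×ˢ P)) ∧
      ∀ r, growth (e.symm '' (A ×ˢ P)) r = (A ^ r).ncard * (P ^ r).ncard := by
  have hpow : ∀ r : ℕ, (e.symm '' (A ×ˢ P)) ^ r = e.symm '' ((A ^ r) ×ˢ (P ^ r)) := by
    intro r
    rw [← Set.image_pow, Set.prod_pow]
  have hgen : IsMonGenSet (e.symm '' (A ×ˢ P)) := by
    refine isMonGenSet_of_forall_mem_pow fun g => ?_
    obtain ⟨m, hm⟩ := hAg (e g).1
    obtain ⟨n, hn⟩ := hPg (e g).2
    refine ⟨max m n, ?_⟩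
    rw [hpow]
    exact ⟨e g, ⟨Set.pow_subset_pow_right hA1 (le_max_left m n) hm,
      Set.pow_subset_pow_right hP1 (le_max_right m n) hn⟩, e.symm_apply_apply g⟩
  refine ⟨(hA.prod hP).image _, ?_, hgen, fun r => ?_⟩
  · rintro _ ⟨x, hx, rfl⟩
    exact ⟨x⁻¹, ⟨hAs _ hx.1, hPs _ hx.2⟩, map_inv _ _⟩
  · rw [growth_eq_ncard_pow_of_one_mem hgen ⟨1, ⟨hA1, hP1⟩, map_one _⟩, hpow,
      Set.ncard_image_of_injective _ e.symm.injective, Set.ncard_prod]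

theorem rk_pi_prod_of_finite {T : Type*} [CommGroup T] [Finite T] (d : ℕ) :
    rk ((Fin d → Multiplicative ℤ) × T) = d := by
  let f : Additive ((Fin d → Multiplicative ℤ) × T) →ₗ[ℤ] (Fin d → ℤ) :=
    AddMonoidHom.toIntLinearMap
      { toFun := fun x i => (x.toMul.1 i).toAdd
        map_zero' := rfl
        map_add' := fun _ _ => rfl }
  have hf : Function.Surjective f := fun v =>
    ⟨Additive.ofMul (fun i => Multiplicative.ofAdd (v i), 1), rfl⟩
  have hker : LinearMap.ker f ≤ Submodule.torsion ℤ _ := by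
    intro x hx
    have hx1 : x.toMul.1 = 1 := funext fun i => congrFun (LinearMap.mem_ker.1 hx) i
    refine (Submodule.mem_torsion_iff x).2
      ⟨⟨Nat.card T, mem_nonZeroDivisors_of_ne_zero (by exact_mod_cast Nat.card_pos.ne')⟩, ?_⟩
    change (Nat.card T : ℤ) • x = 0
    rw [natCast_zsmul]
    apply Additive.toMul.injective
    rw [toMul_nsmul]
    exact Prod.ext (by simp [hx1]) pow_card_eq_one'
  have h1 : Module.finrank ℤ (Additive ((Fin d → Multiplicative ℤ) × T) ⧸ LinearMap.ker f)
      = rk ((Fin d → Multiplicative ℤ) × T) := by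
    rw [rk, Module.finrank, Module.finrank, rank_quotient_eq_of_le_torsion hker]
  rw [← h1, (f.quotKerEquivOfSurjective hf).finrank_eq, Module.finrank_fin_fun]

theorem MulEquiv.rk_eq {G H : Type*} [CommGroup G] [CommGroup H] (e : G ≃* H) : rk G = rk H :=
  (MulEquiv.toAdditive e).toIntLinearEquiv.finrank_eq

theorem MulEquiv.card_torsion_eq {G T : Type*} [CommGroup G] [CommGroup T] [Finite T] {d : ℕ}
    (e : G ≃* (Fin d → Multiplicative ℤ) × T) : Nat.card (CommGroup.torsion G) = Nat.card T := by
  have hmem : ∀ g, g ∈ CommGroup.torsion G ↔ (e g).1 = 1 := by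
    intro g
    change IsOfFinOrder g ↔ _
    rw [isOfFinOrder_iff_pow_eq_one]
    constructor
    · rintro ⟨n, hn, h⟩
      have h1 : (e g) ^ n = 1 := by rw [← map_pow, h, map_one]
      ext i
      have h2 := congrArg Multiplicative.toAdd (congrFun (congrArg Prod.fst h1) i)
      have h3 : n * ((e g).1 i).toAdd = 0 := by simpa using h2
      have h4 : ((e g).1 i).toAdd = 0 := by
        rcases mul_eq_zero.1 h3 with h | h
        · omega
        · exact h
      simpa using h4
    · intro h
      refine ⟨Nat.card T, Nat.card_pos, e.injective ?_⟩
      rw [map_pow, map_one]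
      exact Prod.ext (by simp [h]) pow_card_eq_one'
  refine Nat.card_congr
    { toFun := fun g => (e g).2
      invFun := fun t => ⟨e.symm (1, t), by simp [hmem]⟩
      left_inv := ?_
      right_inv := fun t => by simp }
  rintro ⟨g, hg⟩
  apply Subtype.ext
  apply e.injective
  simp [Prod.ext_iff, (hmem g).1 hg]

theorem exists_mulEquiv_prod (G : Type*) [CommGroup G] (hG : Group.FG G) :
    ∃ (T : Type) (_ : CommGroup T) (_ : Finite T),
      Nonempty (G ≃* (Fin (rk G) → Multiplicative ℤ) × T) ∧
      Nat.card (CommGroup.torsion G) = Nat.card T := by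
  obtain ⟨ι, j, _, _, p, hp, k, ⟨e⟩⟩ := CommGroup.equiv_free_prod_prod_multiplicative_zmod G
  have : ∀ i, NeZero (p i ^ k i) := fun i => ⟨pow_ne_zero _ (hp i).ne_zero⟩
  have : ∀ i, Finite (Multiplicative (ZMod (p i ^ k i))) := fun i =>
    inferInstanceAs (Finite (ZMod (p i ^ k i)))
  let e' : G ≃* (Fin (Fintype.card j) → Multiplicative ℤ) ×
      ((i : ι) → Multiplicative (ZMod (p i ^ k i))) :=
    e.trans (MulEquiv.prodCongr
      (MulEquiv.arrowCongr (Fintype.equivFin j) (MulEquiv.refl _)) (MulEquiv.refl _))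
  have hrk : rk G = Fintype.card j := by rw [e'.rk_eq, rk_pi_prod_of_finite]
  rw [hrk]
  exact ⟨_, _, inferInstance, ⟨e'⟩, e'.card_torsion_eq⟩

/-- Split off one infinite cyclic factor and group it with `T`. -/
def splitFirst (T : Type*) [Group T] (n : ℕ) :
    (Fin (n + 1) → Multiplicative ℤ) × T ≃*
      (Multiplicative ℤ × T) × (Fin n → Multiplicative ℤ) where
  toFun x := ((x.1 0, x.2), Fin.tail x.1)
  invFun y := (Fin.cons y.1.1 y.2, y.1.2)
  left_inv x := by simp
  right_inv y := by simp
  map_mul' _ _ := rfl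

/-- Two finitely generated Abelian groups of non-zero rank admit equal growth
functions with respect to finite symmetric generating sets iff they have the same
rank and torsion parts of the same parity. -/
theorem abelian_equal_growth_symmetric_iff (G G' : Type*) [CommGroup G] [CommGroup G']
    (hG : Group.FG G) (hG' : Group.FG G') (h1 : 1 ≤ rk G) (h1' : 1 ≤ rk G') :
    (∃ (S : Set G) (S' : Set G'), S.Finite ∧ S'.Finite ∧ IsSymmSet S ∧ IsSymmSet S' ∧
        IsMonGenSet S ∧ IsMonGenSet S' ∧ growth S = growth S') ↔
      (rk G = rk G' ∧
        Nat.card (CommGroup.torsion G) % 2 = Nat.card (CommGroup.torsion G') % 2) := by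

  obtain ⟨T, _, _, ⟨e⟩, hT⟩ := exists_mulEquiv_prod G hG
  obtain ⟨T', _, _, ⟨e'⟩, hT'⟩ := exists_mulEquiv_prod G' hG'
  constructor
  · rintro ⟨S, S', hS, hS', hs, hs', hg, hg', h⟩
    refine ⟨le_antisymm (rank_le_of_growth_eq e' e hS' hS hg' hg h.symm)
      (rank_le_of_growth_eq e e' hS hS' hg hg' h), ?_⟩
    have : Finite (CommGroup.torsion G) := Nat.finite_of_card_ne_zero (hT ▸ Nat.card_pos.ne')
    have : Finite (CommGroup.torsion G') := Nat.finite_of_card_ne_zero (hT' ▸ Nat.card_pos.ne')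
    obtain ⟨R, hR⟩ := growth_mod_two hS hs hg
    obtain ⟨R', hR'⟩ := growth_mod_two hS' hs' hg'
    rw [← hR (max R R') (le_max_left _ _), ← hR' (max R R') (le_max_right _ _), h]
  · rintro ⟨hrk, hpar⟩
    rw [hT, hT'] at hpar
    rw [← hrk] at e'
    obtain ⟨n, hn⟩ := Nat.exists_eq_add_of_le' h1
    rw [hn] at e e'
    have hK : Group.FG (Fin n → Multiplicative ℤ) :=
      Group.fg_of_surjective (f := (MonoidHom.snd _ _).comp (e.trans (splitFirst T n)).toMonoidHom)
        (Prod.snd_surjective.comp (e.trans (splitFirst T n)).surjective)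
    obtain ⟨P, hP, hPs, hP1, hPg⟩ := exists_finite_symm_generating _ hK
    obtain ⟨a, i, j, a', i', j', ⟨hj, hji, hi⟩, ⟨hj', hji', hi'⟩, hcard⟩ :=
      exists_strip_ncard_pow_eq T T' hpar
    obtain ⟨hf, hs, hg, hgr⟩ := product_generating_set (e.trans (splitFirst T n))
      (finite_strip T hj hji (by omega)) (fun _ => inv_mem_strip) (one_mem_strip T (by omega))
      (exists_mem_strip_pow T hj hji hi) hP hPs hP1 hPg
    obtain ⟨hf', hs', hg', hgr'⟩ := product_generating_set (e'.trans (splitFirst T' n))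
      (finite_strip T' hj' hji' (by omega)) (fun _ => inv_mem_strip) (one_mem_strip T' (by omega))
      (exists_mem_strip_pow T' hj' hji' hi') hP hPs hP1 hPg
    exact ⟨_, _, hf, hf', hs, hs', hg, hg', funext fun r => by rw [hgr, hgr', hcard]⟩
end

section
/- Let G be a finitely generated Abelian group of rank d and let S be a finite monoid generating set of G. Then limsup_{r → ∞} β_{G,S}(r) / β⁺_d(r) ≥ |tors G|, where the quotient is taken in the real numbers. -/
universe u

/-- A finite vector configuration with a nonnegative linear relation involving a vector outside `W`
contains a positive circuit modulo `W`: a set of vectors outside `W` whose linear relations modulo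
`W` are the multiples of one positive relation. -/
theorem exists_positive_circuit_mod {V : Type*} [AddCommGroup V] [Module ℚ V] [DecidableEq V]
    (X : Finset V) (W : Submodule ℚ V) (n : V → ℚ) (hn : ∀ y, 0 ≤ n y)
    (hsum : ∑ y ∈ X, n y • y = 0) (x : V) (hx : x ∈ X) (hxW : x ∉ W) (hnx : 0 < n x) :
    ∃ C ⊆ X, C.Nonempty ∧ (∀ y ∈ C, y ∉ W) ∧ ∃ c : V → ℚ, (∀ y ∈ C, 0 < c y) ∧
      ∑ y ∈ C, c y • y ∈ W ∧
      ∀ m : V → ℚ, ∑ y ∈ C, m y • y ∈ W → ∃ t : ℚ, ∀ y ∈ C, m y = t * c y := by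
  classical
  let P : Set (Finset V) := {C | C ⊆ X ∧ C.Nonempty ∧ (∀ y ∈ C, y ∉ W) ∧
    ∃ c : V → ℚ, (∀ y ∈ C, 0 < c y) ∧ ∑ y ∈ C, c y • y ∈ W}
  have hP : P.Nonempty := by
    refine ⟨X.filter fun y => y ∉ W ∧ 0 < n y, Finset.filter_subset _ _, ⟨x, by simp [*]⟩,
      fun y hy => (Finset.mem_filter.1 hy).2.1, n, fun y hy => (Finset.mem_filter.1 hy).2.2, ?_⟩
    have h := Finset.sum_filter_add_sum_filter_not X (fun y => y ∉ W ∧ 0 < n y) fun y => n y • y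
    rw [hsum] at h
    rw [eq_neg_of_add_eq_zero_left h]
    refine W.neg_mem (W.sum_mem fun y hy => ?_)
    by_cases hy' : y ∈ W
    · exact W.smul_mem _ hy'
    · have : n y = 0 := by
        refine le_antisymm (not_lt.1 fun h => ?_) (hn y)
        exact (Finset.mem_filter.1 hy).2 ⟨hy', h⟩
      simp [this]
  obtain ⟨C, ⟨hCX, hC, hCW, c, hc, hcW⟩, hmin⟩ := WellFounded.has_min wellFounded_lt P hP
  refine ⟨C, hCX, hC, hCW, c, hc, hcW, fun m hm => ?_⟩
  obtain ⟨z, hz, hmax⟩ := Finset.exists_max_image C (fun y => m y / c y) hC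
  have hle : ∀ y ∈ C, m y ≤ m z / c z * c y := fun y hy =>
    (div_le_iff₀ (hc y hy)).1 (hmax y hy)
  refine ⟨m z / c z, fun y hy => le_antisymm (hle y hy) (not_lt.1 fun hlt => ?_)⟩
  refine hmin (C.filter fun y => m y < m z / c z * c y) ⟨(Finset.filter_subset _ _).trans hCX,
    ⟨y, by simp [hy, hlt]⟩, fun y hy => hCW y (Finset.mem_filter.1 hy).1,
    fun y => m z / c z * c y - m y, fun y hy => sub_pos.2 (Finset.mem_filter.1 hy).2, ?_⟩ ?_
  · rw [Finset.sum_filter_of_ne]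
    · simp only [sub_smul, mul_smul, Finset.sum_sub_distrib, ← Finset.smul_sum]
      exact W.sub_mem (W.smul_mem _ hcW) hm
    · intro y hy hne
      refine lt_of_le_of_ne (hle y hy) fun h => hne ?_
      simp [← h]
  · refine Finset.filter_ssubset.2 ⟨z, hz, ?_⟩
    rw [div_mul_cancel₀ _ (hc z hz).ne']
    exact lt_irrefl _

/-- A finite vector configuration that positively spans `V` contains, modulo any subspace `W`, at
least `dim (V ⧸ W) + 1` bases of `V ⧸ W` whose open simplicial cones are pairwise disjoint. -/
theorem exists_disjoint_simplicial_cones_mod {V : Type u} [AddCommGroup V] [Module ℚ V]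
    [FiniteDimensional ℚ V] [DecidableEq V] (X : Finset V)
    (hspan : Submodule.span ℚ (X : Set V) = ⊤)
    (hpos : ∀ x ∈ X, ∃ n : V → ℚ, (∀ y, 0 ≤ n y) ∧ 0 < n x ∧ ∑ y ∈ X, n y • y = 0)
    (W : Submodule ℚ V) :
    ∃ (J : Type u) (_ : Fintype J) (B : J → Finset V),
      Module.finrank ℚ V + 1 ≤ Fintype.card J + Module.finrank ℚ W ∧
      (∀ j, B j ⊆ X) ∧ (∀ j, Module.finrank ℚ V ≤ (B j).card + Module.finrank ℚ W) ∧
      (∀ j, ∀ a : V → ℚ, ∑ y ∈ B j, a y • y ∈ W → ∀ y ∈ B j, a y = 0) ∧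
      (∀ j k, ∀ a b : V → ℚ, (∀ y ∈ B j, 0 < a y) → (∀ y ∈ B k, 0 < b y) →
        ∑ y ∈ B j, a y • y - ∑ y ∈ B k, b y • y ∈ W → j = k) := by
  classical
  induction W using WellFoundedGT.induction with
  | ind W ih =>
  by_cases hW : W = ⊤
  · subst hW
    refine ⟨PUnit, inferInstance, fun _ => ∅, ?_, ?_, ?_, ?_, ?_⟩ <;> simp [add_comm]
  obtain ⟨x, hxX, hxW⟩ : ∃ x ∈ X, x ∉ W := by
    by_contra! h
    exact hW (top_le_iff.1 (hspan ▸ Submodule.span_le.2 h))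
  obtain ⟨n, hn, hnx, hsum⟩ := hpos x hxX
  obtain ⟨C, hCX, ⟨p, hp⟩, hCW, c, hc, hcW, hcirc⟩ :=
    exists_positive_circuit_mod X W n hn hsum x hxX hxW hnx
  let W' := W ⊔ Submodule.span ℚ ((C.erase p : Finset V) : Set V)
  have hWW' : W ≤ W' := le_sup_left
  have herase : ∀ y ∈ C.erase p, y ∈ W' := fun y hy =>
    (le_sup_right : _ ≤ W') (Submodule.subset_span (by exact_mod_cast hy))
  have hpW' : p ∈ W' := by
    have h : c p • p ∈ W' := by
      rw [← Finset.add_sum_erase _ _ hp] at hcW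
      exact (W'.add_mem_iff_left (W'.sum_mem fun y hy => W'.smul_mem _ (herase y hy))).1
        (hWW' hcW)
    exact (W'.smul_mem_iff (hc p hp).ne').1 h
  have hCW' : ∀ y ∈ C, y ∈ W' := fun y hy => by
    by_cases h : y = p
    · exact h ▸ hpW'
    · exact herase y (Finset.mem_erase.2 ⟨h, hy⟩)
  have hlt : W < W' := lt_of_le_of_ne hWW' fun h => hCW p hp (h ▸ hpW')
  have hdim : Module.finrank ℚ W' ≤ Module.finrank ℚ W + (C.card - 1) := by
    refine (Submodule.finrank_add_le_finrank_add_finrank _ _).trans (Nat.add_le_add_left ?_ _)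
    rw [← Finset.card_erase_of_mem hp]
    exact finrank_span_finset_le_card _
  have hdim' := Submodule.finrank_lt_finrank_of_lt hlt
  obtain ⟨J, _, B, hJ, hBX, hBcard, hind, hdisj⟩ := ih W' hlt
  have hBC : ∀ j, Disjoint (B j) C := fun j => Finset.disjoint_left.2 fun y hy hyC => by
    have := hind j (Pi.single y 1) (W'.sum_mem fun z hz => by
      by_cases h : z = y
      · subst h; exact W'.smul_mem _ (hCW' _ hyC)
      · simp [h]) y hy
    simp at this
  have hBC' : ∀ j q, Disjoint (B j) (C.erase q) := fun j q =>
    (hBC j).mono_right (Finset.erase_subset _ _)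
  have hCsum : ∀ q (a : V → ℚ), ∑ y ∈ C.erase q, a y • y ∈ W' := fun q a =>
    W'.sum_mem fun y hy => W'.smul_mem _ (hCW' y (Finset.mem_of_mem_erase hy))
  have hext : ∀ q (a : V → ℚ), ∑ y ∈ C.erase q, a y • y =
      ∑ y ∈ C, (if y = q then 0 else a y) • y := by
    intro q a
    rw [← Finset.sum_subset (Finset.erase_subset q C)]
    · exact Finset.sum_congr rfl fun y hy => by rw [if_neg (Finset.ne_of_mem_erase hy)]
    · intro y hy hy'
      have : y = q := by_contra fun h => hy' (Finset.mem_erase.2 ⟨h, hy⟩)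
      simp [this]
  refine ⟨J × {y // y ∈ C}, inferInstance, fun j => B j.1 ∪ C.erase j.2, ?_, ?_, ?_, ?_, ?_⟩
  · have hle := Submodule.finrank_le W'
    rw [Fintype.card_prod, Fintype.card_coe]
    obtain ⟨u, hu⟩ : ∃ u, Fintype.card J = u + 1 := ⟨Fintype.card J - 1, by omega⟩
    obtain ⟨v, hv⟩ : ∃ v, C.card = v + 1 := ⟨C.card - 1, by omega⟩
    rw [hu, hv]
    have : (u + 1) * (v + 1) = u * v + u + v + 1 := by ring
    have := Nat.zero_le (u * v)
    omega
  · exact fun j => Finset.union_subset (hBX _) ((Finset.erase_subset _ _).trans hCX)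
  · intro j
    have := hBcard j.1
    rw [Finset.card_union_of_disjoint (hBC' _ _), Finset.card_erase_of_mem j.2.2]
    omega
  · rintro ⟨j, q, hq⟩ a ha
    rw [Finset.sum_union (hBC' _ _)] at ha
    have hB := hind j a ((W'.add_mem_iff_left (hCsum _ _)).1 (hWW' ha))
    rw [Finset.sum_eq_zero fun y hy => by rw [hB y hy, zero_smul], zero_add, hext] at ha
    obtain ⟨t, ht⟩ := hcirc _ ha
    have ht0 : t = 0 := by
      have := ht q hq
      rw [if_pos rfl] at this
      exact (mul_eq_zero.1 this.symm).resolve_right (hc q hq).ne'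
    intro y hy
    rcases Finset.mem_union.1 hy with hy | hy
    · exact hB y hy
    · have := ht y (Finset.mem_of_mem_erase hy)
      rwa [if_neg (Finset.ne_of_mem_erase hy), ht0, zero_mul] at this
  · rintro ⟨j, q, hq⟩ ⟨k, s, hs⟩ a b ha hb hab
    simp only at ha hb hab
    rw [Finset.sum_union (hBC' _ _), Finset.sum_union (hBC' _ _), add_sub_add_comm] at hab
    have hB := (W'.add_mem_iff_left (W'.sub_mem (hCsum _ _) (hCsum _ _))).1 (hWW' hab)
    obtain rfl : j = k := hdisj j k a b (fun y hy => ha y (Finset.mem_union_left _ hy))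
      (fun y hy => hb y (Finset.mem_union_left _ hy)) hB
    rw [← Finset.sum_sub_distrib] at hB hab
    simp only [← sub_smul] at hB hab
    have hB' := hind j (fun y => a y - b y) hB
    rw [Finset.sum_eq_zero fun y hy => by rw [hB' y hy, zero_smul], zero_add, hext, hext,
      ← Finset.sum_sub_distrib] at hab
    simp only [← sub_smul] at hab
    obtain ⟨t, ht⟩ := hcirc _ hab
    by_contra hne
    have hqs : q ≠ s := fun h => hne (by subst h; rfl)
    have h1 := ht q hq
    have h2 := ht s hs
    rw [if_pos rfl, if_neg hqs] at h1
    rw [if_pos rfl, if_neg hqs.symm] at h2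
    have hbq := hb q (Finset.mem_union_right _ (Finset.mem_erase.2 ⟨hqs, hq⟩))
    have has := ha s (Finset.mem_union_right _ (Finset.mem_erase.2 ⟨hqs.symm, hs⟩))
    have hcq := hc q hq
    have hcs := hc s hs
    have ht1 : t < 0 := by
      by_contra! h
      have := mul_nonneg h hcq.le
      linarith
    have := mul_neg_of_neg_of_pos ht1 hcs
    linarith

section WordLength

variable {G : Type*} [Group G] {S : Set G}

theorem IsMonGenSet.exists_list_length_eq_wlen (hS : IsMonGenSet S) (g : G) :
    ∃ l : List G, (∀ x ∈ l, x ∈ S) ∧ l.length = wlen S g ∧ l.prod = g := by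
  obtain ⟨l, hl, hg⟩ := Submonoid.exists_list_of_mem_closure
    (show g ∈ Submonoid.closure S by rw [hS]; trivial)
  exact Nat.sInf_mem (s := {n | ∃ l : List G, (∀ x ∈ l, x ∈ S) ∧ l.length = n ∧ l.prod = g})
    ⟨l.length, l, hl, rfl, hg⟩

theorem wlen_prod_le_length {l : List G} (hl : ∀ x ∈ l, x ∈ S) : wlen S l.prod ≤ l.length :=
  Nat.sInf_le ⟨l, hl, rfl, rfl⟩

theorem wlen_one : wlen S 1 = 0 :=
  Nat.le_zero.1 (wlen_prod_le_length (l := []) (by simp))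

theorem wlen_pow_le {s : G} (hs : s ∈ S) (n : ℕ) : wlen S (s ^ n) ≤ n := by
  simpa using wlen_prod_le_length (S := S) (l := List.replicate n s)
    fun x hx => List.eq_of_mem_replicate hx ▸ hs

theorem IsMonGenSet.wlen_mul_le (hS : IsMonGenSet S) (g h : G) :
    wlen S (g * h) ≤ wlen S g + wlen S h := by
  obtain ⟨l, hl, hlen, hg⟩ := hS.exists_list_length_eq_wlen g
  obtain ⟨l', hl', hlen', hh⟩ := hS.exists_list_length_eq_wlen h
  have := wlen_prod_le_length (S := S) (l := l ++ l') fun x hx =>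
    (List.mem_append.1 hx).elim (hl x) (hl' x)
  rwa [List.prod_append, List.length_append, hg, hh, hlen, hlen'] at this

theorem finite_ball (hfin : S.Finite) (hS : IsMonGenSet S) (r : ℕ) :
    {g : G | wlen S g ≤ r}.Finite := by
  have : Finite S := hfin
  refine ((List.finite_length_le S r).image fun l => (l.map Subtype.val).prod).subset ?_
  intro g hg
  obtain ⟨l, hl, hlen, rfl⟩ := hS.exists_list_length_eq_wlen g
  lift l to List S using hl
  exact ⟨l, by simpa using hlen.trans_le hg, rfl⟩

end WordLength

theorem IsMonGenSet.wlen_prod_pow_le {G ι : Type*} [CommGroup G] {S : Set G} (hS : IsMonGenSet S)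
    (t : Finset ι) (s : ι → G) (hs : ∀ i ∈ t, s i ∈ S) (n : ι → ℕ) :
    wlen S (∏ i ∈ t, s i ^ n i) ≤ ∑ i ∈ t, n i := by
  classical
  induction t using Finset.induction_on with
  | empty => simp [wlen_one]
  | insert i t hi ih =>
    rw [Finset.prod_insert hi, Finset.sum_insert hi]
    exact (hS.wlen_mul_le _ _).trans (add_le_add (wlen_pow_le (hs i (by simp)) _)
      (ih fun j hj => hs j (by simp [hj])))

/-- Tuples of natural numbers of sum at most `m` correspond to tuples with one more entry, the
slack, of sum exactly `m`. -/
def sumLEEquiv (ι : Type*) [Fintype ι] (m : ℕ) :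
    {n : ι → ℕ // ∑ i, n i ≤ m} ≃ {n : Option ι → ℕ // ∑ i, n i = m} where
  toFun n := ⟨fun i => i.elim (m - ∑ i, n.1 i) n.1, by
    simpa [Fintype.sum_option] using Nat.sub_add_cancel n.2⟩
  invFun n := ⟨fun i => n.1 (some i), by
    have := n.2
    rw [Fintype.sum_option] at this
    exact (Nat.le_add_left _ _).trans_eq this⟩
  left_inv n := rfl
  right_inv n := by
    ext i
    have := n.2
    rw [Fintype.sum_option] at this
    cases i with
    | none => exact (Nat.sub_eq_of_eq_add this.symm)
    | some i => rfl

theorem finite_sum_le (ι : Type*) [Fintype ι] (m : ℕ) : Finite {n : ι → ℕ // ∑ i, n i ≤ m} := by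
  classical
  exact Finite.of_equiv _ ((Sym.equivNatSumOfFintype (Option ι) m).trans (sumLEEquiv ι m).symm)

theorem card_sum_le (ι : Type*) [Fintype ι] (m : ℕ) :
    Nat.card {n : ι → ℕ // ∑ i, n i ≤ m} = (m + Fintype.card ι).choose (Fintype.card ι) := by
  classical
  rw [Nat.card_congr ((sumLEEquiv ι m).trans (Sym.equivNatSumOfFintype (Option ι) m).symm),
    Nat.card_eq_fintype_card, Sym.card_sym_eq_choose, Fintype.card_option,
    ← Nat.choose_symm_add]
  congr 1
  omega

theorem ofMul_mem_torsion_int_iff {G : Type*} [CommGroup G] (g : G) :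
    Additive.ofMul g ∈ Submodule.torsion ℤ (Additive G) ↔ g ∈ CommGroup.torsion G := by
  rw [← Submodule.mem_toAddSubgroup, Submodule.torsion_int]
  exact isOfFinAddOrder_ofMul_iff

theorem finite_torsion_of_fg (G : Type*) [CommGroup G] [Group.FG G] :
    Finite (CommGroup.torsion G) := by
  have : Module.Finite ℤ (Additive G) := Module.Finite.iff_addGroup_fg.2 inferInstance
  have : Finite (Submodule.torsion ℤ (Additive G)) :=
    Module.finite_of_fg_torsion _ Submodule.torsion_isTorsion
  exact Finite.of_injective
    (fun g : CommGroup.torsion G => (⟨Additive.ofMul g.1, (ofMul_mem_torsion_int_iff g.1).2 g.2⟩ :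
      Submodule.torsion ℤ (Additive G)))
    fun g h hgh => Subtype.ext (Additive.ofMul.injective (Subtype.mk.inj hgh))

theorem exists_hom_ker_eq_torsion (G : Type*) [CommGroup G] [Group.FG G] :
    ∃ f : Additive G →+ (Fin (rk G) → ℤ), Function.Surjective f ∧
      ∀ g : G, f (Additive.ofMul g) = 0 ↔ g ∈ CommGroup.torsion G := by
  have : Module.Finite ℤ (Additive G) := Module.Finite.iff_addGroup_fg.2 inferInstance
  let T := Submodule.torsion ℤ (Additive G)
  have hrk : Module.finrank ℤ (Additive G ⧸ T) = rk G := finrank_quotient_eq_of_le_torsion le_rfl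
  let e := (Module.finBasisOfFinrankEq ℤ (Additive G ⧸ T) hrk).equivFun
  refine ⟨e.toAddEquiv.toAddMonoidHom.comp T.mkQ.toAddMonoidHom,
    e.surjective.comp T.mkQ_surjective, fun g => ?_⟩
  rw [← ofMul_mem_torsion_int_iff, ← Submodule.Quotient.mk_eq_zero]
  exact e.map_eq_zero_iff

/-- Each of `rk G + 1` disjoint open simplicial cones spanned by the image of `S` contributes to the
growth as much as a standard simplex, once for each torsion element. -/
theorem exists_card_le_growth {G : Type*} [CommGroup G] [Group.FG G] {S : Set G}
    (hfin : S.Finite) (hS : IsMonGenSet S) :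
    ∃ L, ∀ r, L ≤ r → Nat.card (CommGroup.torsion G) *
      ((rk G + 1) * (r - L + rk G).choose (rk G)) ≤ growth S r := by
  classical
  obtain ⟨f, hf, hker⟩ := exists_hom_ker_eq_torsion G
  have := finite_torsion_of_fg G
  have := Fintype.ofFinite (CommGroup.torsion G)
  generalize rk G = d at *
  let φ : Additive G →+ (Fin d → ℚ) := ((Int.castAddHom ℚ).compLeft (Fin d)).comp f
  let F : G → (Fin d → ℚ) := fun g => φ (Additive.ofMul g)
  have hF : ∀ g h, F (g * h) = F g + F h := fun g h => φ.map_add _ _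
  have hF1 : F 1 = 0 := φ.map_zero
  have hFlist : ∀ l : List G, F l.prod = (l.map F).sum := fun l => by
    induction l with
    | nil => exact hF1
    | cons a l ih => rw [List.prod_cons, hF, ih, List.map_cons, List.sum_cons]
  have hFprod : ∀ (B : Finset (Fin d → ℚ)) (σ : (Fin d → ℚ) → G) (n : (Fin d → ℚ) → ℕ),
      F (∏ y ∈ B, σ y ^ n y) = ∑ y ∈ B, n y • F (σ y) := fun B σ n => by
    induction B using Finset.induction_on with
    | empty => simp [hF1]
    | insert i t hi ih =>
      rw [Finset.prod_insert hi, Finset.sum_insert hi, hF, ih]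
      exact congrArg (· + _) (φ.map_nsmul (n i) _)
  have hFtors : ∀ g ∈ CommGroup.torsion G, F g = 0 := fun g hg => by
    have := (hker g).2 hg
    ext i
    simp [F, φ, this]
  let X : Finset (Fin d → ℚ) := hfin.toFinset.image F
  have hXmem : ∀ s ∈ S, F s ∈ X := fun s hs =>
    Finset.mem_image_of_mem F (hfin.mem_toFinset.2 hs)
  have hspan : Submodule.span ℚ (X : Set (Fin d → ℚ)) = ⊤ := by
    have hall : ∀ g, F g ∈ Submodule.span ℚ (X : Set (Fin d → ℚ)) := fun g => by
      obtain ⟨l, hl, -, rfl⟩ := hS.exists_list_length_eq_wlen g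
      rw [hFlist]
      refine list_sum_mem fun y hy => ?_
      obtain ⟨s, hs, rfl⟩ := List.mem_map.1 hy
      exact Submodule.subset_span (hXmem s (hl s hs))
    rw [eq_top_iff, ← (Pi.basisFun ℚ (Fin d)).span_eq, Submodule.span_le]
    rintro _ ⟨i, rfl⟩
    obtain ⟨g, hg⟩ := hf (Pi.single i 1)
    have : F g.toMul = Pi.basisFun ℚ (Fin d) i := by
      ext k
      simp only [F, φ, AddMonoidHom.comp_apply, ofMul_toMul, hg, Pi.basisFun_apply]
      by_cases h : k = i
      · subst h; simp
      · simp [h]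
    exact this ▸ hall _
  have hpos : ∀ x ∈ X, ∃ n : (Fin d → ℚ) → ℚ, (∀ y, 0 ≤ n y) ∧ 0 < n x ∧
      ∑ y ∈ X, n y • y = 0 := by
    intro x hx
    obtain ⟨s, hs, rfl⟩ := Finset.mem_image.1 hx
    obtain ⟨l, hl, -, hls⟩ := hS.exists_list_length_eq_wlen s⁻¹
    refine ⟨fun y => (((s :: l).map F).count y : ℕ), fun y => by positivity,
      Nat.cast_pos.2 (by simp), ?_⟩
    have hsub : ((s :: l).map F).toFinset ⊆ X := by
      intro y hy
      obtain ⟨g, hg, rfl⟩ := List.mem_map.1 (List.mem_toFinset.1 hy)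
      rcases List.mem_cons.1 hg with rfl | hg
      · exact hx
      · exact hXmem g (hl g hg)
    have h := Finset.sum_list_count_of_subset _ X hsub
    rw [← hFlist, List.prod_cons, hls, mul_inv_cancel, hF1] at h
    simp only [Nat.cast_smul_eq_nsmul]
    exact h.symm
  obtain ⟨J, _, B, hJ, hBX, hBcard, hind, hdisj⟩ :=
    exists_disjoint_simplicial_cones_mod X hspan hpos ⊥
  simp only [finrank_bot, Module.finrank_fin_fun, add_zero, Submodule.mem_bot]
    at hJ hBcard hind hdisj
  have hcard : ∀ j, (B j).card = d := fun j => by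
    refine le_antisymm ?_ (hBcard j)
    have h : LinearIndepOn ℚ id (B j : Set (Fin d → ℚ)) :=
      linearIndepOn_finset_iff.2 fun a ha => hind j a ha
    simpa using LinearIndependent.finset_card_le_finrank h
  have hsec : ∀ x, ∃ s, x ∈ X → s ∈ S ∧ F s = x := fun x => by
    by_cases hx : x ∈ X
    · obtain ⟨s, hs, rfl⟩ := Finset.mem_image.1 hx
      exact ⟨s, fun _ => ⟨hfin.mem_toFinset.1 hs, rfl⟩⟩
    · exact ⟨1, fun h => absurd h hx⟩
  choose σ hσ using hsec
  let e : ∀ j, {y // y ∈ B j} ≃ Fin d := fun j => (B j).equivFinOfCardEq (hcard j)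
  let N : J → (Fin d → ℕ) → (Fin d → ℚ) → ℕ := fun j n y =>
    if h : y ∈ B j then n (e j ⟨y, h⟩) + 1 else 0
  have hN : ∀ j n i, N j n ((e j).symm i) = n i + 1 := fun j n i => by simp [N]
  have hNpos : ∀ j n, ∀ y ∈ B j, (0 : ℚ) < N j n y := fun j n y hy => by
    simp only [N, dif_pos hy]; positivity
  have hNsum : ∀ j n, ∑ y ∈ B j, N j n y = ∑ i, n i + d := fun j n => by
    rw [← Finset.sum_coe_sort (B j) (N j n), ← Equiv.sum_comp (e j).symm]
    simp only [hN, Finset.sum_add_distrib]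
    simp
  let Φ : CommGroup.torsion G × J × (Fin d → ℕ) → G := fun p =>
    p.1 * ∏ y ∈ B p.2.1, σ y ^ N p.2.1 p.2.2 y
  have hFΦ : ∀ p, F (Φ p) = ∑ y ∈ B p.2.1, (N p.2.1 p.2.2 y : ℚ) • y := fun p => by
    rw [hF, hFtors _ p.1.2, zero_add, hFprod]
    refine Finset.sum_congr rfl fun y hy => ?_
    rw [(hσ y (hBX _ hy)).2, Nat.cast_smul_eq_nsmul]
  have hΦ : Function.Injective Φ := by
    rintro ⟨t, j, n⟩ ⟨u, k, m⟩ h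
    have hFh := congrArg F h
    rw [hFΦ, hFΦ] at hFh
    obtain rfl : j = k := hdisj j k _ _ (hNpos j n) (hNpos k m) (sub_eq_zero.2 hFh)
    rw [← sub_eq_zero, ← Finset.sum_sub_distrib] at hFh
    simp only [← sub_smul] at hFh
    have hnm := hind j (fun y => (N j n y : ℚ) - N j m y) hFh
    obtain rfl : n = m := funext fun i => by
      have := sub_eq_zero.1 (hnm _ ((e j).symm i).2)
      rw [hN, hN] at this
      exact Nat.succ_injective (by exact_mod_cast this)
    obtain rfl : t = u := Subtype.ext (mul_right_cancel h)
    rfl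
  refine ⟨d + Finset.univ.sup fun t : CommGroup.torsion G => wlen S (t : G), fun r hr => ?_⟩
  set L := d + Finset.univ.sup fun t : CommGroup.torsion G => wlen S (t : G) with hL
  have : Finite {g : G | wlen S g ≤ r} := finite_ball hfin hS r
  have hball : ∀ p : CommGroup.torsion G × J × {n : Fin d → ℕ // ∑ i, n i ≤ r - L},
      wlen S (Φ (p.1, p.2.1, p.2.2.1)) ≤ r := by
    rintro ⟨t, j, n, hn⟩
    have h1 : wlen S (t : G) ≤ Finset.univ.sup fun t : CommGroup.torsion G => wlen S (t : G) :=
      Finset.le_sup (f := fun t : CommGroup.torsion G => wlen S (t : G)) (Finset.mem_univ t)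
    have h2 := hS.wlen_prod_pow_le (B j) σ (fun y hy => (hσ y (hBX j hy)).1) (N j n)
    rw [hNsum] at h2
    have h3 := hS.wlen_mul_le (t : G) (∏ y ∈ B j, σ y ^ N j n y)
    change wlen S ((t : G) * ∏ y ∈ B j, σ y ^ N j n y) ≤ r
    omega
  have hle := Nat.card_le_card_of_injective
    (fun p => (⟨_, hball p⟩ : {g : G | wlen S g ≤ r})) (by
      rintro ⟨t, j, n⟩ ⟨u, k, m⟩ h
      have := hΦ (Subtype.mk.inj h)
      simp only [Prod.mk.injEq, Subtype.ext_iff] at this ⊢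
      exact this)
  rw [Nat.card_prod, Nat.card_prod, card_sum_le, Fintype.card_fin, Nat.card_coe_set_eq,
    Nat.card_eq_fintype_card (α := J)] at hle
  exact (Nat.mul_le_mul_left _ (Nat.mul_le_mul_right _ hJ)).trans hle

theorem exists_growth_le {G : Type*} [CommGroup G] [Group.FG G] {S : Set G}
    (hfin : S.Finite) (hS : IsMonGenSet S) :
    ∃ k : ℕ, ∀ r, growth S r ≤ Nat.card (CommGroup.torsion G) * (2 * (k * r) + 1) ^ rk G := by
  classical
  obtain ⟨f, hf, hker⟩ := exists_hom_ker_eq_torsion G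
  have := finite_torsion_of_fg G
  let F : G → (Fin (rk G) → ℤ) := fun g => f (Additive.ofMul g)
  have hF : ∀ g h, F (g * h) = F g + F h := fun g h => f.map_add _ _
  let k := hfin.toFinset.sup fun s => Finset.univ.sup fun i => (F s i).natAbs
  have hk : ∀ s ∈ S, ∀ i, (F s i).natAbs ≤ k := fun s hs i =>
    (Finset.le_sup (f := fun i => (F s i).natAbs) (Finset.mem_univ i)).trans
      (Finset.le_sup (f := fun s => Finset.univ.sup fun i => (F s i).natAbs)
        (hfin.mem_toFinset.2 hs))
  have hlist : ∀ l : List G, (∀ x ∈ l, x ∈ S) → ∀ i, (F l.prod i).natAbs ≤ k * l.length := by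
    intro l hl i
    induction l with
    | nil => simp [F]
    | cons a l ih =>
      have h1 := hk a (hl a (by simp)) i
      have h2 := ih fun x hx => hl x (by simp [hx])
      rw [List.prod_cons, hF, Pi.add_apply, List.length_cons, Nat.mul_succ]
      omega
  refine ⟨k, fun r => ?_⟩
  have hball := finite_ball hfin hS r
  rw [growth, Set.ncard_eq_toFinset_card _ hball]
  let box : Finset (Fin (rk G) → ℤ) := Fintype.piFinset fun _ =>
    Finset.Icc (-((k * r : ℕ) : ℤ)) ((k * r : ℕ) : ℤ)
  have hbox : box.card = (2 * (k * r) + 1) ^ rk G := by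
    simp only [box, Fintype.card_piFinset, Int.card_Icc, Finset.prod_const, Finset.card_univ,
      Fintype.card_fin]
    congr 1
    omega
  rw [← hbox]
  refine Finset.card_le_mul_card_image_of_maps_to (f := F) (fun g hg => ?_) _ fun b hb => ?_
  · obtain ⟨l, hl, hlen, rfl⟩ := hS.exists_list_length_eq_wlen g
    have hr : wlen S l.prod ≤ r := by simpa using hg
    refine Fintype.mem_piFinset.2 fun i => Finset.mem_Icc.2 ?_
    have h1 := hlist l hl i
    have h2 : k * l.length ≤ k * r := Nat.mul_le_mul_left _ (hlen ▸ hr)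
    omega
  · rcases (hball.toFinset.filter fun g => F g = b).eq_empty_or_nonempty with h | ⟨g₀, hg₀⟩
    · simp [h]
    have := Fintype.ofFinite (CommGroup.torsion G)
    rw [Nat.card_eq_fintype_card]
    refine (Finset.card_le_card ?_).trans (Finset.card_image_le (s := Finset.univ)
      (f := fun t : CommGroup.torsion G => (t : G) * g₀))
    intro g hg
    have hgg₀ : F (g * g₀⁻¹) = 0 := by
      have h := hF (g * g₀⁻¹) g₀
      rw [inv_mul_cancel_right, (Finset.mem_filter.1 hg).2, (Finset.mem_filter.1 hg₀).2] at h
      exact left_eq_add.1 ((add_comm _ _).trans h.symm).symm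
    exact Finset.mem_image.2 ⟨⟨g * g₀⁻¹, (hker _).1 hgg₀⟩, Finset.mem_univ _,
      inv_mul_cancel_right _ _⟩

/-- The elements of `stdMonSet d`: `none` gives `(-1, …, -1)`, `some i` gives the `i`-th standard
basis vector. -/
def stdMonVec (d : ℕ) : Option (Fin d) → Multiplicative (Fin d → ℤ)
  | none => Multiplicative.ofAdd fun _ => -1
  | some i => Multiplicative.ofAdd (Pi.single i 1)

theorem stdMonVec_mem {d : ℕ} (i : Option (Fin d)) : stdMonVec d i ∈ stdMonSet d := by
  cases i with
  | none => exact Or.inr rfl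
  | some i => exact Or.inl ⟨i, rfl⟩

theorem exists_stdMonVec_eq {d : ℕ} {x : Multiplicative (Fin d → ℤ)} (hx : x ∈ stdMonSet d) :
    ∃ i, stdMonVec d i = x := by
  rcases hx with ⟨i, rfl⟩ | rfl
  · exact ⟨some i, rfl⟩
  · exact ⟨none, rfl⟩

theorem finite_stdMonSet (d : ℕ) : (stdMonSet d).Finite :=
  (Set.finite_range (stdMonVec d)).subset fun _ => exists_stdMonVec_eq

theorem toAdd_prod_stdMonVec_pow {d : ℕ} (n : Option (Fin d) → ℕ) (k : Fin d) :
    (∏ i, stdMonVec d i ^ n i).toAdd k = n (some k) - n none := by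
  simp [Fintype.prod_option, stdMonVec, toAdd_prod, Finset.sum_apply, Pi.single_apply]
  ring

theorem isMonGenSet_stdMonSet (d : ℕ) : IsMonGenSet (stdMonSet d) := by
  refine eq_top_iff.2 fun x _ => ?_
  let M := ∑ i, (x.toAdd i).natAbs
  have hM : ∀ i, (x.toAdd i).natAbs ≤ M := fun i =>
    Finset.single_le_sum (f := fun i => (x.toAdd i).natAbs) (fun _ _ => Nat.zero_le _)
      (Finset.mem_univ i)
  have : x = ∏ i, stdMonVec d i ^ (i.elim M fun i => (x.toAdd i + M).toNat : ℕ) := by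
    refine Multiplicative.toAdd.injective (funext fun k => ?_)
    rw [toAdd_prod_stdMonVec_pow]
    have := hM k
    simp only [Option.elim]
    omega
  rw [this]
  exact Submonoid.prod_mem _ fun i _ => Submonoid.pow_mem _ (Submonoid.subset_closure
    (stdMonVec_mem i)) _

theorem choose_le_betaPlus (d r : ℕ) : (r + d).choose d ≤ betaPlus d r := by
  have : Finite {g | wlen (stdMonSet d) g ≤ r} :=
    finite_ball (finite_stdMonSet d) (isMonGenSet_stdMonSet d) r
  have h := card_sum_le (Fin d) r
  rw [Fintype.card_fin] at h
  rw [betaPlus, growth, ← Nat.card_coe_set_eq, ← h]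
  let c : (Fin d → ℕ) → Option (Fin d) → ℕ := fun n i => i.elim 0 n
  refine Nat.card_le_card_of_injective
    (fun n => ⟨∏ i, stdMonVec d i ^ c n.1 i, ?_⟩) fun n m hnm => ?_
  · refine ((isMonGenSet_stdMonSet d).wlen_prod_pow_le _ _ (fun i _ => stdMonVec_mem i) _).trans ?_
    simpa [Fintype.sum_option, c] using n.2
  · refine Subtype.ext (funext fun k => ?_)
    have := congrFun (congrArg Multiplicative.toAdd (Subtype.mk.inj hnm)) k
    rw [toAdd_prod_stdMonVec_pow, toAdd_prod_stdMonVec_pow] at this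
    simpa [c] using this

/-- A word in the standard monoid generators can be shortened until one generator is missing. -/
theorem exists_eq_prod_stdMonVec_pow {d : ℕ} (x : Multiplicative (Fin d → ℤ)) :
    ∃ n : Option (Fin d) → ℕ, (∃ i, n i = 0) ∧ ∑ i, n i ≤ wlen (stdMonSet d) x ∧
      ∏ i, stdMonVec d i ^ n i = x := by
  classical
  obtain ⟨l, hl, hlen, rfl⟩ := (isMonGenSet_stdMonSet d).exists_list_length_eq_wlen x
  have : ∃ n : Option (Fin d) → ℕ, ∑ i, n i ≤ l.length ∧ ∏ i, stdMonVec d i ^ n i = l.prod := by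
    clear hlen
    induction l with
    | nil => exact ⟨0, by simp⟩
    | cons a l ih =>
      obtain ⟨n, hn, hprod⟩ := ih fun x hx => hl x (by simp [hx])
      obtain ⟨i, rfl⟩ := exists_stdMonVec_eq (hl a (by simp))
      refine ⟨n + Pi.single i 1, ?_, ?_⟩
      · simpa [Finset.sum_add_distrib] using hn
      · simp only [Pi.add_apply, pow_add, Finset.prod_mul_distrib, hprod, List.prod_cons]
        rw [mul_comm]
        congr 1
        rw [Finset.prod_eq_single i] <;> simp +contextual
  obtain ⟨n, hn, hprod⟩ := this
  obtain ⟨i, -, hi⟩ := Finset.exists_min_image Finset.univ n Finset.univ_nonempty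
  refine ⟨fun k => n k - n i, ⟨i, Nat.sub_self _⟩, ?_, ?_⟩
  · rw [← hlen]
    exact (Finset.sum_le_sum fun k _ => Nat.sub_le _ _).trans hn
  · rw [← hprod]
    refine Multiplicative.toAdd.injective (funext fun k => ?_)
    rw [toAdd_prod_stdMonVec_pow, toAdd_prod_stdMonVec_pow]
    have h1 := hi none (Finset.mem_univ _)
    have h2 := hi (some k) (Finset.mem_univ _)
    omega

theorem betaPlus_le (d r : ℕ) : betaPlus d r ≤ (d + 1) * (r + d).choose d := by
  classical
  let D := Σ i : Option (Fin d), {n : {k // k ≠ i} → ℕ // ∑ k, n k ≤ r}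
  have hfin : ∀ i : Option (Fin d), Finite {n : {k // k ≠ i} → ℕ // ∑ k, n k ≤ r} :=
    fun i => finite_sum_le _ r
  let u : D → Multiplicative (Fin d → ℤ) := fun p =>
    ∏ k : {k // k ≠ p.1}, stdMonVec d k ^ p.2.1 k
  have hsub : {g | wlen (stdMonSet d) g ≤ r} ⊆ Set.range u := by
    intro x hx
    obtain ⟨n, ⟨i, hi⟩, hn, rfl⟩ := exists_eq_prod_stdMonVec_pow x
    refine ⟨⟨i, fun k => n k, ?_⟩, ?_⟩
    · have := Fintype.sum_eq_add_sum_subtype_ne n i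
      have : ∑ k, n k ≤ r := hn.trans hx
      change ∑ k : {k // k ≠ i}, n k ≤ r
      omega
    · have := Fintype.prod_eq_mul_prod_subtype_ne (fun k => stdMonVec d k ^ n k) i
      rw [hi, pow_zero, one_mul] at this
      exact this.symm
  calc betaPlus d r ≤ Nat.card (Set.range u) := by
        rw [Nat.card_coe_set_eq]
        exact Set.ncard_le_ncard hsub (Set.finite_range u)
    _ ≤ Nat.card D := Finite.card_range_le u
    _ = (d + 1) * (r + d).choose d := by
        rw [Nat.card_sigma]
        simp [card_sum_le]

theorem tendsto_choose_div_choose (L d : ℕ) :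
    Filter.Tendsto (fun r : ℕ => ((r - L + d).choose d : ℝ) / ((r + d).choose d : ℝ))
      Filter.atTop (nhds 1) := by
  have h1 : Filter.Tendsto (fun r : ℕ => r - L + d) Filter.atTop Filter.atTop :=
    (Filter.tendsto_add_atTop_nat d).comp (Filter.tendsto_sub_atTop_nat L)
  have h2 : Filter.Tendsto (fun r : ℕ => r + d) Filter.atTop Filter.atTop :=
    Filter.tendsto_add_atTop_nat d
  have h := ((isEquivalent_choose d).comp_tendsto h1).div ((isEquivalent_choose d).comp_tendsto h2)
  refine h.tendsto_nhds_iff.2 ?_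
  have h3 : Filter.Tendsto (fun r : ℕ => (1 - (L : ℝ) / ((r + d : ℕ) : ℝ)) ^ d) Filter.atTop
      (nhds 1) := by
    simpa using ((tendsto_const_nhds (x := (1 : ℝ))).sub
      ((tendsto_const_div_atTop_nhds_zero_nat (L : ℝ)).comp h2)).pow d
  refine h3.congr' ?_
  filter_upwards [Filter.eventually_ge_atTop (L + 1)] with r hr
  have hpos : ((r + d : ℕ) : ℝ) ≠ 0 := by
    have : r + d ≠ 0 := by omega
    exact_mod_cast this
  have hfac : (d.factorial : ℝ) ≠ 0 := by exact_mod_cast d.factorial_ne_zero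
  have hsub : ((r - L + d : ℕ) : ℝ) = ((r + d : ℕ) : ℝ) - L := by
    rw [← Nat.cast_sub (by omega)]
    congr 1
    omega
  simp only [Function.comp_apply, Pi.div_apply]
  rw [hsub, div_div_div_cancel_right₀ hfac, ← div_pow, sub_div, div_self hpos]

/-- Minimal growth, monoid case: for a finitely generated Abelian group `G` of
rank `d` and a finite monoid generating set `S`,
`limsup_{r → ∞} β_{G,S}(r) / β⁺_d(r) ≥ |tors G|`. -/
theorem limsup_growth_div_betaPlus_ge_card_torsion (G : Type*) [CommGroup G]
    (S : Set G) (hfin : S.Finite) (hgen : IsMonGenSet S) :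
    (Nat.card (CommGroup.torsion G) : ℝ) ≤
      Filter.limsup (fun r : ℕ => (growth S r : ℝ) / (betaPlus (rk G) r : ℝ)) Filter.atTop := by
  have : Group.FG G := Group.fg_iff_monoid_fg.2 ⟨hfin.toFinset, by rwa [hfin.coe_toFinset]⟩
  obtain ⟨L, hL⟩ := exists_card_le_growth hfin hgen
  obtain ⟨k, hk⟩ := exists_growth_le hfin hgen
  generalize rk G = d at *
  generalize Nat.card (CommGroup.torsion G) = T at *
  have hchoose : ∀ r : ℕ, (0 : ℝ) < ((r + d).choose d : ℝ) := fun r => by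
    exact_mod_cast Nat.choose_pos (Nat.le_add_left d r)
  have hbeta : ∀ r, ((r + d).choose d : ℝ) ≤ betaPlus d r := fun r => by
    exact_mod_cast choose_le_betaPlus d r
  have hbeta' : ∀ r, (betaPlus d r : ℝ) ≤ (d + 1) * ((r + d).choose d : ℝ) := fun r => by
    exact_mod_cast betaPlus_le d r
  have hlim : Filter.Tendsto
      (fun r : ℕ => (T : ℝ) * (((r - L + d).choose d : ℝ) / ((r + d).choose d : ℝ)))
      Filter.atTop (nhds T) := by
    simpa using (tendsto_choose_div_choose L d).const_mul (T : ℝ)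
  rw [← hlim.limsup_eq]
  refine Filter.limsup_le_limsup ?_ hlim.isCoboundedUnder_le ?_
  · filter_upwards [Filter.eventually_ge_atTop L] with r hr
    have h : (T : ℝ) * ((d + 1) * ((r - L + d).choose d : ℝ)) ≤ growth S r := by
      exact_mod_cast hL r hr
    rw [le_div_iff₀ ((hchoose r).trans_le (hbeta r))]
    calc _ ≤ (T : ℝ) * (((r - L + d).choose d : ℝ) / ((r + d).choose d : ℝ)) *
          ((d + 1) * ((r + d).choose d : ℝ)) := by
          gcongr
          exact hbeta' r
      _ = (T : ℝ) * ((d + 1) * ((r - L + d).choose d : ℝ)) := by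
          have := (hchoose r).ne'
          field_simp
      _ ≤ _ := h
  · refine Filter.isBoundedUnder_of ⟨T * ((2 * k + 1) ^ d * d.factorial), fun r => ?_⟩
    have h1 : (growth S r : ℝ) ≤ T * (2 * (k * r) + 1) ^ d := by exact_mod_cast hk r
    have h2 : ((r + 1 : ℝ) ^ d) ≤ d.factorial * ((r + d).choose d : ℝ) := by
      have h := Nat.pow_le_choose (α := ℝ) d (r + d)
      rw [div_le_iff₀ (by positivity), show r + d + 1 - d = r + 1 by omega] at h
      push_cast at h
      linarith
    rw [div_le_iff₀ ((hchoose r).trans_le (hbeta r))]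
    calc (growth S r : ℝ) ≤ T * (2 * (k * r) + 1) ^ d := h1
      _ ≤ T * ((2 * k + 1) * (r + 1)) ^ d := by
          gcongr
          have : (0 : ℝ) ≤ k := Nat.cast_nonneg k
          have : (0 : ℝ) ≤ r := Nat.cast_nonneg r
          nlinarith
      _ = T * (2 * k + 1) ^ d * (r + 1) ^ d := by rw [mul_pow, mul_assoc]
      _ ≤ T * (2 * k + 1) ^ d * (d.factorial * ((r + d).choose d : ℝ)) := by gcongr
      _ ≤ T * (2 * k + 1) ^ d * (d.factorial * betaPlus d r) := by
          have := hbeta r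
          gcongr ?_ * (_ * ?_)
      _ = _ := by ring
end
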